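/- Let α > 0, v₁, v₂ < α, λ ∈ ℂ, and set v = v₁ + v₂. Then for every t > 0 the convolution of two R functions with the same order and the same eigenvalue satisfies ∫_0^t R_{α,v₁}(λ,t−τ) R_{α,v₂}(λ,τ) dτ = (t/α) R_{α, v+1−α}(λ,t) + ((v+1−α)/α) R_{α, v−α}(λ,t). -/

import Mathlib

open MeasureTheory

/-- Two-parameter Mittag-Leffler function, using the entire reciprocal Gamma
function (Mathlib's `Complex.Gamma` vanishes at nonpositive integers, so its
inverse is the entire reciprocal Gamma). -/
noncomputable def mlE (α β : ℝ) (z : ℂ) : ℂ :=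
  ∑' n : ℕ, z ^ n * (Complex.Gamma ((α * n + β : ℝ) : ℂ))⁻¹

/-- The `P` function: `P_{α,w}(λ,t) = t^w E_{α,w+1}(λ t^α)`. -/
noncomputable def Pfun (α w : ℝ) (lam : ℂ) (t : ℝ) : ℂ :=
  ((t ^ w : ℝ) : ℂ) * mlE α (w + 1) (lam * ((t ^ α : ℝ) : ℂ))

/-- The `R` (Lorenzo–Hartley) function: `R_{α,v}(λ,t) = t^{α-v-1} E_{α,α-v}(λ t^α)`. -/
noncomputable def Rfun (α v : ℝ) (lam : ℂ) (t : ℝ) : ℂ :=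
  ((t ^ (α - v - 1) : ℝ) : ℂ) * mlE α (α - v) (lam * ((t ^ α : ℝ) : ℂ))

/-- Restricting the Gamma integral to `(R, ∞)` gives `R ^ (s - 1) * exp (-R) ≤ Γ(s)`. -/
lemma Real.rpow_mul_exp_neg_le_Gamma {s R : ℝ} (hs : 1 ≤ s) (hR : 0 < R) :
    R ^ (s - 1) * Real.exp (-R) ≤ Real.Gamma s := by
  have hint : IntegrableOn (fun x : ℝ => Real.exp (-x) * x ^ (s - 1)) (Set.Ioi 0) :=
    Real.GammaIntegral_convergent (by linarith)
  rw [Real.Gamma_eq_integral (by linarith), ← integral_exp_neg_Ioi, ← integral_const_mul]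
  calc ∫ x in Set.Ioi R, R ^ (s - 1) * Real.exp (-x)
      ≤ ∫ x in Set.Ioi R, Real.exp (-x) * x ^ (s - 1) := by
        refine setIntegral_mono_on ((integrableOn_exp_neg_Ioi R).const_mul _)
          (hint.mono_set (Set.Ioi_subset_Ioi hR.le)) measurableSet_Ioi fun x hx => ?_
        rw [mul_comm]
        exact mul_le_mul_of_nonneg_left (Real.rpow_le_rpow hR.le (Set.mem_Ioi.1 hx).le
          (by linarith)) (Real.exp_pos _).le
    _ ≤ ∫ x in Set.Ioi 0, Real.exp (-x) * x ^ (s - 1) := by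
        refine setIntegral_mono_set hint ?_ (Set.Ioi_subset_Ioi hR.le).eventuallyLE
        filter_upwards [ae_restrict_mem measurableSet_Ioi] with x hx
        have := Set.mem_Ioi.1 hx
        simp only [Pi.zero_apply]
        positivity

/-- The Mittag-Leffler series converges absolutely. -/
lemma summable_norm_mittagLeffler {α : ℝ} (hα : 0 < α) (β : ℝ) (z : ℂ) :
    Summable fun n : ℕ => ‖z ^ n * (((Real.Gamma (α * n + β))⁻¹ : ℝ) : ℂ)‖ := by
  set R : ℝ := (2 * ‖z‖ + 1) ^ α⁻¹ with hRdef
  have hR : 0 < R := by positivity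
  have hRα : R ^ α = 2 * ‖z‖ + 1 := by
    rw [hRdef, ← Real.rpow_mul (by positivity), inv_mul_cancel₀ hα.ne', Real.rpow_one]
  have hgeom : Summable fun n : ℕ => (R ^ (β - 1) * Real.exp (-R))⁻¹ * (1 / 2 : ℝ) ^ n :=
    summable_geometric_two.mul_left _
  refine hgeom.of_norm_bounded_eventually_nat ?_
  have hev : ∀ᶠ n : ℕ in Filter.atTop, 1 ≤ α * n + β :=
    (Filter.tendsto_atTop_add_const_right _ β
      (tendsto_natCast_atTop_atTop.const_mul_atTop hα)).eventually_ge_atTop 1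
  filter_upwards [hev] with n hn
  have hΓ : 0 < Real.Gamma (α * n + β) := Real.Gamma_pos_of_pos (by linarith)
  have hle := Real.rpow_mul_exp_neg_le_Gamma hn hR
  have hpow : R ^ (α * n + β - 1) = (2 * ‖z‖ + 1) ^ n * R ^ (β - 1) := by
    rw [add_sub_assoc, Real.rpow_add hR, Real.rpow_mul hR.le, hRα, Real.rpow_natCast]
  rw [hpow] at hle
  rw [norm_norm, norm_mul, norm_pow, Complex.norm_real, Real.norm_of_nonneg (by positivity)]
  calc ‖z‖ ^ n * (Real.Gamma (α * n + β))⁻¹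
      ≤ ‖z‖ ^ n * ((2 * ‖z‖ + 1) ^ n * R ^ (β - 1) * Real.exp (-R))⁻¹ := by gcongr
    _ = (R ^ (β - 1) * Real.exp (-R))⁻¹ * (‖z‖ / (2 * ‖z‖ + 1)) ^ n := by
        rw [div_pow]
        field_simp
    _ ≤ (R ^ (β - 1) * Real.exp (-R))⁻¹ * (1 / 2 : ℝ) ^ n := by
        gcongr ?_ * ?_ ^ n
        rw [div_le_div_iff₀ (by positivity) two_pos]
        linarith

/-- The real coefficient of `λ ^ n` in the series of an `R` function. -/
noncomputable def rCoeff (α β t : ℝ) (n : ℕ) : ℝ :=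
  t ^ (α * n + β - 1) * (Real.Gamma (α * n + β))⁻¹

lemma pow_mul_rCoeff (α β : ℝ) (lam : ℂ) {t : ℝ} (ht : 0 < t) (n : ℕ) :
    lam ^ n * (rCoeff α β t n : ℂ) = ((t ^ (β - 1) : ℝ) : ℂ) *
      ((lam * ((t ^ α : ℝ) : ℂ)) ^ n * (((Real.Gamma (α * n + β))⁻¹ : ℝ) : ℂ)) := by
  rw [rCoeff, add_sub_assoc, Real.rpow_add ht, Real.rpow_mul ht.le, Real.rpow_natCast]
  push_cast
  ring

lemma summable_norm_rCoeff {α : ℝ} (hα : 0 < α) (β : ℝ) (lam : ℂ) {t : ℝ} (ht : 0 < t) :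
    Summable fun n : ℕ => ‖lam ^ n * (rCoeff α β t n : ℂ)‖ := by
  simp_rw [pow_mul_rCoeff α β lam ht, norm_mul ((t ^ (β - 1) : ℝ) : ℂ)]
  exact (summable_norm_mittagLeffler hα β _).mul_left _

lemma Rfun_eq_tsum (α v : ℝ) (lam : ℂ) {t : ℝ} (ht : 0 < t) :
    Rfun α v lam t = ∑' n : ℕ, lam ^ n * (rCoeff α (α - v) t n : ℂ) := by
  simp_rw [pow_mul_rCoeff α (α - v) lam ht, tsum_mul_left, Rfun, mlE, Complex.Gamma_ofReal,
    Complex.ofReal_inv]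

/-- The coefficients satisfy the three-term relation coming from `Γ(s + 1) = s Γ(s)`. -/
lemma succ_mul_rCoeff {α : ℝ} (hα : 0 < α) (c : ℝ) {t : ℝ} (ht : 0 < t) (n : ℕ) :
    (n + 1) * rCoeff α c t n =
      t / α * rCoeff α (c - 1) t n + (α + 1 - c) / α * rCoeff α c t n := by
  have hΓ : (Real.Gamma (α * n + (c - 1)))⁻¹ =
      (α * n + (c - 1)) * (Real.Gamma (α * n + c))⁻¹ := by
    rcases eq_or_ne (α * n + (c - 1)) 0 with h | h
    · simp [h]
    · have := Real.Gamma_add_one h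
      rw [show α * n + (c - 1) + 1 = α * n + c by ring] at this
      rw [this, mul_inv, mul_inv_cancel_left₀ h]
  have hpow : t ^ (α * n + c - 1) = t * t ^ (α * n + (c - 1) - 1) := by
    rw [show α * n + c - 1 = 1 + (α * n + (c - 1) - 1) by ring, Real.rpow_add ht, Real.rpow_one]
  rw [rCoeff, rCoeff, hΓ, hpow]
  field_simp
  ring

/-- The Beta integral on `[0, t]` with real exponents. -/
lemma integral_rpow_mul_sub_rpow {p q t : ℝ} (hp : 0 < p) (hq : 0 < q) (ht : 0 < t) :
    ∫ x in (0 : ℝ)..t, (t - x) ^ (p - 1) * x ^ (q - 1) =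
      t ^ (p + q - 1) * (Real.Gamma p * Real.Gamma q / Real.Gamma (p + q)) := by
  have h := Complex.betaIntegral_scaled (q : ℂ) (p : ℂ) ht
  rw [Complex.betaIntegral_eq_Gamma_mul_div _ _ (by simpa) (by simpa)] at h
  apply Complex.ofReal_injective
  rw [← intervalIntegral.integral_ofReal]
  have hcongr : ∫ x in (0 : ℝ)..t, (((t - x) ^ (p - 1) * x ^ (q - 1) : ℝ) : ℂ) =
      ∫ x in (0 : ℝ)..t, (x : ℂ) ^ ((q : ℂ) - 1) * ((t : ℂ) - x) ^ ((p : ℂ) - 1) := by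
    refine intervalIntegral.integral_congr fun x hx => ?_
    rw [Set.uIcc_of_le ht.le] at hx
    rw [Complex.ofReal_mul, Complex.ofReal_cpow (sub_nonneg.2 hx.2), Complex.ofReal_cpow hx.1]
    push_cast
    ring
  rw [hcongr, h, Complex.ofReal_mul, Complex.ofReal_cpow ht.le]
  push_cast
  rw [← Complex.Gamma_ofReal, ← Complex.Gamma_ofReal, ← Complex.Gamma_ofReal]
  push_cast
  rw [add_comm (q : ℂ) p, mul_comm (Complex.Gamma q)]

lemma integral_rCoeff_mul_rCoeff {α a b t : ℝ} (hα : 0 < α) (ha : 0 < a) (hb : 0 < b)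
    (ht : 0 < t) (i j : ℕ) :
    ∫ x in (0 : ℝ)..t, rCoeff α a (t - x) i * rCoeff α b x j = rCoeff α (a + b) t (i + j) := by
  have hp : 0 < α * i + a := by positivity
  have hq : 0 < α * j + b := by positivity
  have := (Real.Gamma_pos_of_pos hp).ne'
  have := (Real.Gamma_pos_of_pos hq).ne'
  simp_rw [rCoeff, mul_mul_mul_comm, intervalIntegral.integral_mul_const,
    integral_rpow_mul_sub_rpow hp hq ht]
  rw [show α * ((i + j : ℕ) : ℝ) + (a + b) = (α * i + a) + (α * j + b) by push_cast; ring]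
  field_simp

lemma intervalIntegrable_rCoeff_mul_rCoeff {α a b t : ℝ} (hα : 0 < α) (ha : 0 < a) (hb : 0 < b)
    (ht : 0 < t) (i j : ℕ) :
    IntervalIntegrable (fun x => rCoeff α a (t - x) i * rCoeff α b x j) volume 0 t := by
  apply intervalIntegral.intervalIntegrable_of_integral_ne_zero
  rw [integral_rCoeff_mul_rCoeff hα ha hb ht, rCoeff]
  have : 0 < Real.Gamma (α * ((i + j : ℕ) : ℝ) + (a + b)) := Real.Gamma_pos_of_pos (by positivity)
  positivity

/-- The coefficient of `λ ^ n` in the product of two `R` series at `t - x` and `x`. -/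
noncomputable def convCoeff (α a b t : ℝ) (n : ℕ) (x : ℝ) : ℝ :=
  ∑ ij ∈ Finset.HasAntidiagonal.antidiagonal n, rCoeff α a (t - x) ij.1 * rCoeff α b x ij.2

lemma rCoeff_nonneg {α β t : ℝ} (hα : 0 < α) (hβ : 0 < β) (ht : 0 ≤ t) (n : ℕ) :
    0 ≤ rCoeff α β t n := by
  have : 0 < Real.Gamma (α * n + β) := Real.Gamma_pos_of_pos (by positivity)
  unfold rCoeff
  positivity

lemma convCoeff_nonneg {α a b t x : ℝ} (hα : 0 < α) (ha : 0 < a) (hb : 0 < b)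
    (hx : 0 ≤ x) (hxt : x ≤ t) (n : ℕ) : 0 ≤ convCoeff α a b t n x :=
  Finset.sum_nonneg fun _ _ =>
    mul_nonneg (rCoeff_nonneg hα ha (sub_nonneg.2 hxt) _) (rCoeff_nonneg hα hb hx _)

lemma intervalIntegrable_convCoeff {α a b t : ℝ} (hα : 0 < α) (ha : 0 < a) (hb : 0 < b)
    (ht : 0 < t) (n : ℕ) : IntervalIntegrable (convCoeff α a b t n) volume 0 t := by
  have hsum : convCoeff α a b t n = ∑ ij ∈ Finset.HasAntidiagonal.antidiagonal n,
      fun x => rCoeff α a (t - x) ij.1 * rCoeff α b x ij.2 := by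
    ext x
    simp [convCoeff]
  rw [hsum]
  exact IntervalIntegrable.sum _
    fun ij _ => intervalIntegrable_rCoeff_mul_rCoeff hα ha hb ht ij.1 ij.2

lemma integral_convCoeff {α a b t : ℝ} (hα : 0 < α) (ha : 0 < a) (hb : 0 < b)
    (ht : 0 < t) (n : ℕ) :
    ∫ x in (0 : ℝ)..t, convCoeff α a b t n x = (n + 1) * rCoeff α (a + b) t n := by
  simp_rw [convCoeff]
  rw [intervalIntegral.integral_finsetSum
    fun ij _ => intervalIntegrable_rCoeff_mul_rCoeff hα ha hb ht ij.1 ij.2]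
  simp_rw [integral_rCoeff_mul_rCoeff hα ha hb ht]
  rw [Finset.sum_congr rfl fun ij hij => by rw [Finset.HasAntidiagonal.mem_antidiagonal.1 hij]]
  simp

/-- Cauchy product of the series of two `R` functions. -/
lemma Rfun_mul_Rfun_eq_tsum {α : ℝ} (hα : 0 < α) (v₁ v₂ : ℝ) (lam : ℂ) {t x : ℝ}
    (hx : 0 < x) (hxt : x < t) :
    Rfun α v₁ lam (t - x) * Rfun α v₂ lam x =
      ∑' n : ℕ, lam ^ n * (convCoeff α (α - v₁) (α - v₂) t n x : ℂ) := by
  have hx' := sub_pos.2 hxt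
  rw [Rfun_eq_tsum α v₁ lam hx', Rfun_eq_tsum α v₂ lam hx,
    tsum_mul_tsum_eq_tsum_sum_antidiagonal_of_summable_norm
      (summable_norm_rCoeff hα _ lam hx') (summable_norm_rCoeff hα _ lam hx)]
  refine tsum_congr fun n => ?_
  rw [convCoeff, Complex.ofReal_sum, Finset.mul_sum]
  refine Finset.sum_congr rfl fun ij hij => ?_
  rw [← Finset.HasAntidiagonal.mem_antidiagonal.1 hij, pow_add]
  push_cast
  ring

lemma hasSum_succ_mul_rCoeff {α : ℝ} (hα : 0 < α) (c : ℝ) (lam : ℂ) {t : ℝ} (ht : 0 < t) :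
    HasSum (fun n : ℕ => lam ^ n * (((n + 1) * rCoeff α c t n : ℝ) : ℂ))
      (((t / α : ℝ) : ℂ) * (∑' n : ℕ, lam ^ n * (rCoeff α (c - 1) t n : ℂ)) +
        (((α + 1 - c) / α : ℝ) : ℂ) * ∑' n : ℕ, lam ^ n * (rCoeff α c t n : ℂ)) := by
  have h := ((summable_norm_rCoeff hα (c - 1) lam ht).of_norm.hasSum.mul_left
    ((t / α : ℝ) : ℂ)).add ((summable_norm_rCoeff hα c lam ht).of_norm.hasSum.mul_left
    (((α + 1 - c) / α : ℝ) : ℂ))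
  refine h.congr_fun fun n => ?_
  rw [succ_mul_rCoeff hα c ht n]
  push_cast
  ring

/-- Same-order, same-eigenvalue convolution identity for `R` functions:
for `α > 0`, `v₁, v₂ < α`, `v = v₁ + v₂` and `t > 0`,
`(R_{α,v₁}(λ,·) * R_{α,v₂}(λ,·))(t) = (t/α) R_{α,v+1-α}(λ,t) + ((v+1-α)/α) R_{α,v-α}(λ,t)`. -/
theorem conv_Rfun_same_order_same_eigenvalue (α v₁ v₂ : ℝ) (hα : 0 < α)
    (hv₁ : v₁ < α) (hv₂ : v₂ < α) (lam : ℂ) (t : ℝ) (ht : 0 < t) :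
    (∫ τ in (0 : ℝ)..t, Rfun α v₁ lam (t - τ) * Rfun α v₂ lam τ) =
      ((t / α : ℝ) : ℂ) * Rfun α ((v₁ + v₂) + 1 - α) lam t +
        ((((v₁ + v₂) + 1 - α) / α : ℝ) : ℂ) * Rfun α ((v₁ + v₂) - α) lam t := by
  have ha := sub_pos.2 hv₁
  have hb := sub_pos.2 hv₂
  have hint (n : ℕ) : IntegrableOn
      (fun x => lam ^ n * (convCoeff α (α - v₁) (α - v₂) t n x : ℂ)) (Set.Ioo 0 t) :=
    (((intervalIntegrable_iff_integrableOn_Ioo_of_le ht.le).1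
      (intervalIntegrable_convCoeff hα ha hb ht n)).ofReal).const_mul _
  have hval (n : ℕ) : ∫ x in Set.Ioo 0 t, convCoeff α (α - v₁) (α - v₂) t n x =
      (n + 1) * rCoeff α ((α - v₁) + (α - v₂)) t n := by
    rw [← integral_convCoeff hα ha hb ht, intervalIntegral.integral_of_le ht.le,
      integral_Ioc_eq_integral_Ioo]
  have hnorm (n : ℕ) :
      ∫ x in Set.Ioo 0 t, ‖lam ^ n * (convCoeff α (α - v₁) (α - v₂) t n x : ℂ)‖ =
        ‖lam ^ n * (((n + 1) * rCoeff α ((α - v₁) + (α - v₂)) t n : ℝ) : ℂ)‖ := by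
    have hnn := rCoeff_nonneg hα (add_pos ha hb) ht.le n
    rw [norm_mul, Complex.norm_real, Real.norm_of_nonneg (by positivity), ← hval,
      ← integral_const_mul]
    refine setIntegral_congr_fun measurableSet_Ioo fun x hx => ?_
    rw [norm_mul, Complex.norm_real,
      Real.norm_of_nonneg (convCoeff_nonneg hα ha hb hx.1.le hx.2.le n)]
  have hR := hasSum_succ_mul_rCoeff hα ((α - v₁) + (α - v₂)) lam ht
  have hL := hasSum_integral_of_summable_integral_norm hint
    (by simpa only [hnorm] using hR.summable.norm)
  simp_rw [integral_const_mul, integral_complex_ofReal, hval] at hL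
  rw [intervalIntegral.integral_of_le ht.le, integral_Ioc_eq_integral_Ioo,
    setIntegral_congr_fun measurableSet_Ioo
      fun x hx => Rfun_mul_Rfun_eq_tsum hα v₁ v₂ lam hx.1 hx.2,
    hL.unique hR, Rfun_eq_tsum _ _ _ ht, Rfun_eq_tsum _ _ _ ht,
    show α - v₁ + (α - v₂) - 1 = α - (v₁ + v₂ + 1 - α) by ring,
    show α - v₁ + (α - v₂) = α - (v₁ + v₂ - α) by ring,
    show α + 1 - (α - (v₁ + v₂ - α)) = v₁ + v₂ + 1 - α by ring]
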